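/- arXiv:2510.07788 — 3 statements merged into one kernel-verified Lean document; each statement's English description precedes it below -/
import Mathlib

section
/- Telescoping of partial sums of squared one-step Clebsch–Gordan coefficients: for every Young diagram λ with at most d rows, every i ∈ [d], and every s with 1 ≤ s ≤ d, one has ∑_{k=1}^{s} c²_{k→i} = D_{s→i}. -/
open Finset

/-- The Weyl dimension polynomial `WD_p(mu) = prod_{1 <= a < b <= p} ((mu_a - mu_b) + (b - a))/(b - a)`
of the integer tuple `(mu 1, ..., mu p)`. -/
def weylDim (p : ℕ) (μ : ℕ → ℤ) : ℚ :=
  ∏ a ∈ Finset.Icc 1 p, ∏ b ∈ Finset.Icc (a + 1) p,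
    (((μ a : ℚ) - (μ b : ℚ)) + ((b : ℚ) - (a : ℚ))) / ((b : ℚ) - (a : ℚ))

/-- `addBox μ y = μ + e_y`: the tuple `μ` with `1` added in coordinate `y`. -/
def addBox (μ : ℕ → ℤ) (y : ℕ) : ℕ → ℤ := fun x => μ x + if x = y then 1 else 0

/-- The dimension ratio `D^μ_{k→y} = WD_k(μ + e_y)/WD_k(μ)` for `y ≤ k`, and `0` for `k < y`
(division by zero evaluates to `0`). -/
def dimRatio (μ : ℕ → ℤ) (k y : ℕ) : ℚ :=
  if y ≤ k then weylDim k (addBox μ y) / weylDim k μ else 0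

/-- `D_{k→i}` for the Young diagram `lam`. -/
def dimR (lam : ℕ → ℕ) (k i : ℕ) : ℚ := dimRatio (fun x => (lam x : ℤ)) k i

/-- The squared one-step Clebsch–Gordan coefficient `c²_{k→i}`. -/
def csq (lam : ℕ → ℕ) (k i : ℕ) : ℚ :=
  if i ≤ k then
    |(∏ j ∈ (Finset.Icc 1 (k - 1)).erase i,
        ((((lam j : ℚ) - (lam i : ℚ)) + ((i : ℚ) - (j : ℚ))) - 1) /
          (((lam j : ℚ) - (lam i : ℚ)) + ((i : ℚ) - (j : ℚ)))) *
      (1 / ((((lam i : ℚ) - (lam k : ℚ)) + ((k : ℚ) - (i : ℚ))) + (if i = k then 1 else 0)))|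
  else 0

/-- The factor contributed by row `j` to the dimension ratio for adding a box in row `i`. -/
def boxFactor (μ : ℕ → ℤ) (i j : ℕ) : ℚ :=
  (((μ j : ℚ) - (μ i : ℚ)) + ((i : ℚ) - (j : ℚ)) - 1) / (((μ j : ℚ) - (μ i : ℚ)) + ((i : ℚ) - (j : ℚ)))

theorem weyl_factor_ratio (μ : ℕ → ℤ) (i a b : ℕ) (hab : a < b) (hμ : μ b ≤ μ a) :
    ((((addBox μ i a : ℤ) : ℚ) - ((addBox μ i b : ℤ) : ℚ) + ((b : ℚ) - (a : ℚ))) /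
        ((b : ℚ) - (a : ℚ))) /
      (((μ a : ℚ) - (μ b : ℚ) + ((b : ℚ) - (a : ℚ))) / ((b : ℚ) - (a : ℚ))) =
    (if a = i then boxFactor μ i b else 1) * (if b = i then boxFactor μ i a else 1) := by
  have hab' : (0 : ℚ) < (b : ℚ) - a := sub_pos.2 (by exact_mod_cast hab)
  have hμ' : (0 : ℚ) ≤ (μ a : ℚ) - μ b := sub_nonneg.2 (by exact_mod_cast hμ)
  have hne : (μ a : ℚ) - μ b + (b - a) ≠ 0 := by positivity
  rw [div_div_div_cancel_right₀ hab'.ne']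
  by_cases ha : a = i
  · subst ha
    have hne' : (μ b : ℚ) - μ a + (a - b) ≠ 0 := fun h => hne (by linarith)
    simp only [addBox, hab.ne', boxFactor, if_true, if_false, mul_one]
    rw [div_eq_div_iff hne hne']
    push_cast
    ring
  · by_cases hb : b = i
    · subst hb
      simp only [addBox, hab.ne, boxFactor, if_true, if_false, one_mul]
      push_cast
      congr 1
      ring
    · simp [addBox, ha, hb, div_self hne]

theorem dimRatio_eq_prod (μ : ℕ → ℤ) (k i : ℕ) (h1 : 1 ≤ i) (hik : i ≤ k)
    (hμ : ∀ a b, 1 ≤ a → a < b → b ≤ k → μ b ≤ μ a) :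
    dimRatio μ k i = ∏ j ∈ (Finset.Icc 1 k).erase i, boxFactor μ i j := by
  rw [dimRatio, if_pos hik, weylDim, weylDim, ← Finset.prod_div_distrib]
  have hpair : ∀ a ∈ Finset.Icc 1 k,
      (∏ b ∈ Finset.Icc (a + 1) k,
          (((addBox μ i a : ℤ) : ℚ) - ((addBox μ i b : ℤ) : ℚ) + ((b : ℚ) - (a : ℚ))) /
            ((b : ℚ) - (a : ℚ))) /
        (∏ b ∈ Finset.Icc (a + 1) k,
          ((μ a : ℚ) - (μ b : ℚ) + ((b : ℚ) - (a : ℚ))) / ((b : ℚ) - (a : ℚ))) =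
      (if a = i then ∏ b ∈ Finset.Icc (i + 1) k, boxFactor μ i b else 1) *
        (if a < i then boxFactor μ i a else 1) := by
    intro a ha
    rw [Finset.mem_Icc] at ha
    rw [← Finset.prod_div_distrib]
    have hfactor : ∀ b ∈ Finset.Icc (a + 1) k, _ = _ := fun b hb =>
      weyl_factor_ratio μ i a b (Finset.mem_Icc.1 hb).1
        (hμ a b ha.1 (Finset.mem_Icc.1 hb).1 (Finset.mem_Icc.1 hb).2)
    rw [Finset.prod_congr rfl hfactor, Finset.prod_mul_distrib, Finset.prod_ite_eq']
    congr 1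
    · split_ifs with h
      · rw [h]
      · simp
    · simp [hik]
  rw [Finset.prod_congr rfl hpair, Finset.prod_mul_distrib, Finset.prod_ite_eq',
    if_pos (Finset.mem_Icc.2 ⟨h1, hik⟩), ← Finset.prod_filter,
    ← Finset.prod_union (Finset.disjoint_left.2 fun a ha hb => by
      simp only [Finset.mem_Icc, Finset.mem_filter] at ha hb
      omega)]
  refine Finset.prod_congr ?_ fun _ _ => rfl
  ext j
  simp only [Finset.mem_union, Finset.mem_Icc, Finset.mem_filter, Finset.mem_erase]
  omega

theorem boxFactor_nonneg (μ : ℕ → ℤ) (i j : ℕ) (hlt : j < i → μ i ≤ μ j)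
    (hgt : i < j → μ j ≤ μ i) (hij : j ≠ i) : 0 ≤ boxFactor μ i j := by
  rcases lt_or_gt_of_ne hij with h | h
  · have h1 : (j : ℚ) + 1 ≤ i := by exact_mod_cast h
    have h2 : (μ i : ℚ) ≤ μ j := by exact_mod_cast hlt h
    exact div_nonneg (by linarith) (by linarith)
  · have h1 : (i : ℚ) + 1 ≤ j := by exact_mod_cast h
    have h2 : (μ j : ℚ) ≤ μ i := by exact_mod_cast hgt h
    exact div_nonneg_of_nonpos (by linarith) (by linarith)

theorem boxFactor_eq_one_add (μ : ℕ → ℤ) (i j : ℕ) (hij : i < j) (hμ : μ j ≤ μ i) :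
    boxFactor μ i j = 1 + 1 / ((μ i : ℚ) - μ j + (j - i)) := by
  have h1 : (i : ℚ) < j := by exact_mod_cast hij
  have h2 : (μ j : ℚ) ≤ μ i := by exact_mod_cast hμ
  have hne : (μ i : ℚ) - μ j + (j - i) ≠ 0 := by linarith
  have hne' : (μ j : ℚ) - μ i + (i - j) ≠ 0 := by linarith
  rw [boxFactor, one_add_div hne, div_eq_div_iff hne' hne]
  ring

theorem le_of_step_le {d : ℕ} {lam : ℕ → ℕ}
    (hlam : ∀ k, 1 ≤ k → k + 1 ≤ d → lam (k + 1) ≤ lam k) {a b : ℕ}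
    (ha : 1 ≤ a) (hab : a ≤ b) (hb : b ≤ d) : lam b ≤ lam a := by
  induction b, hab using Nat.le_induction with
  | base => exact le_rfl
  | succ b hab ih => exact (hlam b (ha.trans hab) hb).trans (ih (by omega))

/-- The squared coefficient is the increment of the dimension ratio. -/
theorem csq_eq_dimR_sub {d : ℕ} {lam : ℕ → ℕ}
    (hlam : ∀ k, 1 ≤ k → k + 1 ≤ d → lam (k + 1) ≤ lam k)
    {i k : ℕ} (hi : 1 ≤ i) (hk : k + 1 ≤ d) :
    csq lam (k + 1) i = dimR lam (k + 1) i - dimR lam k i := by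
  by_cases hik : i ≤ k + 1
  swap
  · simp [csq, dimR, dimRatio, hik, show ¬ i ≤ k by omega]
  set μ : ℕ → ℤ := fun x => (lam x : ℤ) with hμdef
  have hμ : ∀ a b, 1 ≤ a → a < b → b ≤ k + 1 → μ b ≤ μ a := fun a b ha hab hb =>
    Int.ofNat_le.2 (le_of_step_le hlam ha hab.le (hb.trans hk))
  set P := ∏ j ∈ (Finset.Icc 1 k).erase i, boxFactor μ i j with hP
  have hP0 : 0 ≤ P := Finset.prod_nonneg fun j hj => by
    simp only [Finset.mem_erase, Finset.mem_Icc] at hj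
    exact boxFactor_nonneg μ i j (fun h => hμ j i hj.2.1 h hik)
      (fun h => hμ i j hi h (by omega)) hj.1
  have hcsq : csq lam (k + 1) i = |P * (1 / ((μ i : ℚ) - μ (k + 1) + (((k + 1 : ℕ) : ℚ) - i) +
      if i = k + 1 then 1 else 0))| := by
    simp only [csq, if_pos hik, Nat.add_sub_cancel, hP, boxFactor, hμdef, Int.cast_natCast]
  have hD : dimR lam (k + 1) i = ∏ j ∈ (Finset.Icc 1 (k + 1)).erase i, boxFactor μ i j :=
    dimRatio_eq_prod μ (k + 1) i hi hik hμ
  rw [hcsq, hD]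
  rcases hik.eq_or_lt with rfl | hlt
  · have herase : (Finset.Icc 1 (k + 1)).erase (k + 1) = (Finset.Icc 1 k).erase (k + 1) := by
      ext j
      simp only [Finset.mem_erase, Finset.mem_Icc]
      omega
    rw [herase, ← hP]
    simp [dimR, dimRatio, abs_of_nonneg hP0]
  · have hDk : dimR lam k i = P :=
      dimRatio_eq_prod μ k i hi (by omega) fun a b ha hab hb => hμ a b ha hab (by omega)
    have herase : (Finset.Icc 1 (k + 1)).erase i =
        insert (k + 1) ((Finset.Icc 1 k).erase i) := by
      ext j
      simp only [Finset.mem_erase, Finset.mem_Icc, Finset.mem_insert]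
      omega
    have hle := hμ i (k + 1) hi hlt le_rfl
    have hpos : 0 ≤ (μ i : ℚ) - μ (k + 1) + (((k + 1 : ℕ) : ℚ) - i) :=
      add_nonneg (sub_nonneg.2 (by exact_mod_cast hle)) (sub_nonneg.2 (by exact_mod_cast hik))
    rw [hDk, herase, Finset.prod_insert (by simp), ← hP, boxFactor_eq_one_add μ i _ hlt hle,
      if_neg hlt.ne, add_zero, abs_of_nonneg (mul_nonneg hP0 (one_div_nonneg.2 hpos))]
    ring

theorem telescoping_one_step_CG
    (d : ℕ) (hd : 1 ≤ d) (lam : ℕ → ℕ)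
    (hlam : ∀ k, 1 ≤ k → k + 1 ≤ d → lam (k + 1) ≤ lam k)
    (i s : ℕ) (hi : i ∈ Finset.Icc 1 d) (hs : s ∈ Finset.Icc 1 d) :
    ∑ k ∈ Finset.Icc 1 s, csq lam k i = dimR lam s i := by
  have hi1 := (Finset.mem_Icc.1 hi).1
  have hsd := (Finset.mem_Icc.1 hs).2
  clear hs
  induction s with
  | zero => simp [dimR, dimRatio, show i ≠ 0 by omega]
  | succ s ih =>
    rw [Finset.sum_Icc_succ_top (by omega), ih (by omega), csq_eq_dimR_sub hlam hi1 hsd]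
    ring
end

section
/- First-moment combinatorial identity for every legal Young-diagram transformation: let λ be a Young diagram with at most d rows and let μ = (μ_1, …, μ_d) ∈ ℝ^d satisfy ∑_{m∈B} μ_m = ∑_{m∈B} λ↑_m for every block B of λ. Then for every i ∈ [d], ∑_{k=1}^{d} μ_k · c²_{k→i} = (λ_i + 1 − i) · D_{d→i}. -/
open Finset

/-- The box-donation transformation `λ↑`. -/
def donate (d : ℕ) (lam : ℕ → ℕ) (k : ℕ) : ℤ :=
  (lam k : ℤ)
    - (((Finset.Icc 1 d).filter fun j => j < k ∧ lam k < lam j).card : ℤ)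
    + (((Finset.Icc 1 d).filter fun j => k < j ∧ lam j < lam k).card : ℤ)

/-- `IsBlock d lam a b`: the consecutive indices `{a, …, b} ⊆ [d]` form a block of `lam`. -/
def IsBlock (d : ℕ) (lam : ℕ → ℕ) (a b : ℕ) : Prop :=
  1 ≤ a ∧ a ≤ b ∧ b ≤ d ∧ lam a = lam b ∧
    (a = 1 ∨ lam a < lam (a - 1)) ∧ (b = d ∨ lam (b + 1) < lam b)

/-- The shifted difference `C_j - C_i` of the contents of rows `j` and `i`. -/
def contentDiff (lam : ℕ → ℕ) (i j : ℕ) : ℚ :=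
  ((lam j : ℚ) - (lam i : ℚ)) + ((i : ℚ) - (j : ℚ))

/-- The product formula for the dimension ratio `D_{k→i}`, meaningful for `i ≤ k`. -/
def ratioProd (lam : ℕ → ℕ) (k i : ℕ) : ℚ :=
  ∏ j ∈ (Finset.Icc 1 k).erase i, (contentDiff lam i j - 1) / contentDiff lam i j

section Rows

variable {d : ℕ} {lam : ℕ → ℕ}

theorem rows_antitone (hlam : ∀ k, 1 ≤ k → k + 1 ≤ d → lam (k + 1) ≤ lam k)
    {j k : ℕ} (hj : 1 ≤ j) (hjk : j ≤ k) (hk : k ≤ d) : lam k ≤ lam j := by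
  induction k, hjk using Nat.le_induction with
  | base => exact le_rfl
  | succ n hn ih => exact (hlam n (by omega) hk).trans (ih (by omega))

theorem one_le_contentDiff (hlam : ∀ k, 1 ≤ k → k + 1 ≤ d → lam (k + 1) ≤ lam k)
    {i j : ℕ} (hj : 1 ≤ j) (hji : j < i) (hi : i ≤ d) : 1 ≤ contentDiff lam i j := by
  have h1 : (lam i : ℚ) ≤ lam j := by exact_mod_cast rows_antitone hlam hj hji.le hi
  have h2 : (j : ℚ) + 1 ≤ i := by exact_mod_cast hji
  unfold contentDiff
  linarith

theorem contentDiff_le_neg_one (hlam : ∀ k, 1 ≤ k → k + 1 ≤ d → lam (k + 1) ≤ lam k)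
    {i j : ℕ} (hi : 1 ≤ i) (hij : i < j) (hj : j ≤ d) : contentDiff lam i j ≤ -1 := by
  have h := one_le_contentDiff hlam hi hij hj
  unfold contentDiff at *
  linarith

theorem contentDiff_ne_zero (hlam : ∀ k, 1 ≤ k → k + 1 ≤ d → lam (k + 1) ≤ lam k)
    {i j : ℕ} (hi : 1 ≤ i) (hid : i ≤ d) (hj : 1 ≤ j) (hjd : j ≤ d) (hij : j ≠ i) :
    contentDiff lam i j ≠ 0 := by
  rcases lt_or_gt_of_ne hij with h | h
  · linarith [one_le_contentDiff hlam hj h hid]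
  · linarith [contentDiff_le_neg_one hlam hi h hjd]

theorem ratioProd_nonneg (hlam : ∀ k, 1 ≤ k → k + 1 ≤ d → lam (k + 1) ≤ lam k)
    {i k : ℕ} (hi : 1 ≤ i) (hid : i ≤ d) (hk : k ≤ d) : 0 ≤ ratioProd lam k i := by
  refine Finset.prod_nonneg fun j hj => ?_
  simp only [Finset.mem_erase, Finset.mem_Icc] at hj
  rcases lt_or_gt_of_ne hj.1 with h | h
  · have := one_le_contentDiff hlam hj.2.1 h hid
    exact div_nonneg (by linarith) (by linarith)
  · have := contentDiff_le_neg_one hlam hi h (by omega)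
    exact div_nonneg_of_nonpos (by linarith) (by linarith)

theorem ratioProd_succ {i k : ℕ} (h : k + 1 ≠ i) :
    ratioProd lam (k + 1) i
      = ratioProd lam k i * ((contentDiff lam i (k + 1) - 1) / contentDiff lam i (k + 1)) := by
  unfold ratioProd
  rw [← Finset.insert_Icc_right_eq_Icc_add_one (by omega), Finset.erase_insert_of_ne h,
    Finset.prod_insert (by simp), mul_comm]

theorem ratioProd_succ_self (k : ℕ) : ratioProd lam (k + 1) (k + 1) = ratioProd lam k (k + 1) := by
  unfold ratioProd
  congr 1
  ext j
  simp only [Finset.mem_erase, Finset.mem_Icc]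
  omega

theorem csq_of_lt {i k : ℕ} (h : k < i) : csq lam k i = 0 := if_neg (by omega)

theorem csq_self (hlam : ∀ k, 1 ≤ k → k + 1 ≤ d → lam (k + 1) ≤ lam k)
    {i : ℕ} (hi : 1 ≤ i) (hid : i ≤ d) : csq lam i i = ratioProd lam i i := by
  obtain ⟨k, rfl⟩ : ∃ k, i = k + 1 := ⟨i - 1, by omega⟩
  rw [ratioProd_succ_self]
  have h := ratioProd_nonneg hlam hi hid (k := k) (by omega)
  unfold ratioProd contentDiff at *
  simp only [csq, le_refl, if_true, Nat.add_sub_cancel, sub_self, zero_add, div_one, mul_one]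
  exact abs_of_nonneg h

theorem csq_succ (hlam : ∀ k, 1 ≤ k → k + 1 ≤ d → lam (k + 1) ≤ lam k)
    {i k : ℕ} (hi : 1 ≤ i) (hik : i ≤ k) (hk : k + 1 ≤ d) :
    csq lam (k + 1) i = ratioProd lam k i / -contentDiff lam i (k + 1) := by
  have h := ratioProd_nonneg hlam hi (by omega) (k := k) (by omega)
  have h' := contentDiff_le_neg_one hlam hi (Nat.lt_succ_of_le hik) hk
  have e : ((lam i : ℚ) - (lam (k + 1) : ℚ)) + (((k + 1 : ℕ) : ℚ) - (i : ℚ))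
      = -contentDiff lam i (k + 1) := by
    unfold contentDiff; ring
  rw [csq, if_pos (by omega), if_neg (by omega), add_zero, e, Nat.add_sub_cancel,
    mul_one_div]
  exact abs_of_nonneg (div_nonneg h (by linarith))

theorem csq_succ_eq_sub (hlam : ∀ k, 1 ≤ k → k + 1 ≤ d → lam (k + 1) ≤ lam k)
    {i k : ℕ} (hi : 1 ≤ i) (hik : i ≤ k) (hk : k + 1 ≤ d) :
    csq lam (k + 1) i = ratioProd lam (k + 1) i - ratioProd lam k i := by
  have h := contentDiff_ne_zero hlam hi (by omega) (by omega) hk (j := k + 1) (by omega)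
  rw [csq_succ hlam hi hik hk, ratioProd_succ (by omega)]
  field_simp
  ring

theorem csq_succ_eq_of_row_eq (hlam : ∀ k, 1 ≤ k → k + 1 ≤ d → lam (k + 1) ≤ lam k)
    {i k : ℕ} (hi : 1 ≤ i) (hid : i ≤ d) (hk : 1 ≤ k) (hkd : k + 1 ≤ d)
    (heq : lam (k + 1) = lam k) : csq lam (k + 1) i = csq lam k i := by
  rcases lt_trichotomy i k with h | rfl | h
  · obtain ⟨n, rfl⟩ : ∃ n, k = n + 1 := ⟨k - 1, by omega⟩
    have e : contentDiff lam i (n + 1 + 1) = contentDiff lam i (n + 1) - 1 := by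
      simp only [contentDiff, heq]; push_cast; ring
    have h1 := contentDiff_le_neg_one hlam hi h (by omega)
    have h2 : contentDiff lam i (n + 1) ≠ 0 := by linarith
    have h3 : contentDiff lam i (n + 1) - 1 ≠ 0 := by linarith
    rw [csq_succ hlam hi (by omega) hkd, csq_succ hlam hi (by omega) (by omega),
      ratioProd_succ (by omega), e]
    field_simp
  · have e : contentDiff lam i (i + 1) = -1 := by
      simp only [contentDiff, heq]; push_cast; ring
    rw [csq_succ hlam hi le_rfl hkd, csq_self hlam hi hid, e, neg_neg, div_one]
  · rw [csq_of_lt h]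
    rcases (Nat.succ_le_of_lt h).lt_or_eq with h' | h'
    · exact csq_of_lt h'
    · subst h'
      rw [Nat.succ_eq_add_one, csq_self hlam hi hid]
      refine Finset.prod_eq_zero (i := k) (by simp; omega) ?_
      have e : contentDiff lam (k + 1) k = 1 := by
        simp only [contentDiff, heq]; push_cast; ring
      simp [e]

theorem csq_eq_of_row_eq (hlam : ∀ k, 1 ≤ k → k + 1 ≤ d → lam (k + 1) ≤ lam k)
    {i a k : ℕ} (hi : 1 ≤ i) (hid : i ≤ d) (ha : 1 ≤ a) (hak : a ≤ k) (hkd : k ≤ d)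
    (heq : lam k = lam a) : csq lam k i = csq lam a i := by
  induction k, hak using Nat.le_induction with
  | base => rfl
  | succ n hn ih =>
    have h1 := hlam n (by omega) hkd
    have h2 := rows_antitone hlam ha hn (by omega)
    rw [csq_succ_eq_of_row_eq hlam hi hid (by omega) hkd (by omega),
      ih (by omega) (by omega)]

/-- The partial sums of `c²_{k→i}` are the dimension ratios. -/
theorem sum_csq (hlam : ∀ k, 1 ≤ k → k + 1 ≤ d → lam (k + 1) ≤ lam k)
    {i n : ℕ} (hi : 1 ≤ i) (hin : i ≤ n) (hn : n ≤ d) :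
    ∑ k ∈ Finset.Icc 1 n, csq lam k i = ratioProd lam n i := by
  induction n, hin using Nat.le_induction with
  | base =>
    rw [Finset.sum_eq_single_of_mem i (by simp; omega), csq_self hlam hi hn]
    intro b hb hne
    simp only [Finset.mem_Icc] at hb
    exact csq_of_lt (by omega)
  | succ n hin ih =>
    rw [Finset.sum_Icc_succ_top (by omega), ih (by omega), csq_succ_eq_sub hlam hi hin hn]
    ring

theorem sum_staircase_mul_csq (hlam : ∀ k, 1 ≤ k → k + 1 ≤ d → lam (k + 1) ≤ lam k)
    {i n : ℕ} (hi : 1 ≤ i) (hin : i ≤ n) (hn : n ≤ d) :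
    ∑ k ∈ Finset.Icc 1 n, ((lam k : ℚ) + n + 1 - 2 * k) * csq lam k i
      = ((lam i : ℚ) + 1 - i) * ratioProd lam n i := by
  induction n, hin using Nat.le_induction with
  | base =>
    rw [Finset.sum_eq_single_of_mem i (by simp; omega), csq_self hlam hi hn]
    · ring
    intro b hb hne
    simp only [Finset.mem_Icc] at hb
    rw [csq_of_lt (by omega), mul_zero]
  | succ n hin ih =>
    have hsplit : ∑ k ∈ Finset.Icc 1 n, ((lam k : ℚ) + (n + 1 : ℕ) + 1 - 2 * k) * csq lam k i
        = ((lam i : ℚ) + 1 - i) * ratioProd lam n i + ratioProd lam n i := by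
      rw [← ih (by omega)]
      rw [← sum_csq hlam hi hin (by omega), ← Finset.sum_add_distrib]
      refine Finset.sum_congr rfl fun k _ => ?_
      push_cast
      ring
    have h := contentDiff_ne_zero hlam hi (by omega) (by omega) hn (j := n + 1) (by omega)
    have hD : ratioProd lam n i = -contentDiff lam i (n + 1) * csq lam (n + 1) i := by
      rw [csq_succ hlam hi hin hn]
      field_simp
    rw [Finset.sum_Icc_succ_top (by omega), hsplit]
    have hS : ratioProd lam (n + 1) i = ratioProd lam n i + csq lam (n + 1) i := by
      rw [csq_succ_eq_sub hlam hi hin hn]; ring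
    rw [hS, hD]
    simp only [contentDiff]
    push_cast
    ring

end Rows

section Weyl

theorem weylDim_succ (p : ℕ) (μ : ℕ → ℤ) :
    weylDim (p + 1) μ = weylDim p μ * ∏ a ∈ Finset.Icc 1 p,
      (((μ a : ℚ) - (μ (p + 1) : ℚ)) + (((p + 1 : ℕ) : ℚ) - (a : ℚ)))
        / (((p + 1 : ℕ) : ℚ) - (a : ℚ)) := by
  unfold weylDim
  rw [Finset.prod_Icc_succ_top (by omega), Finset.Icc_eq_empty (a := p + 1 + 1) (by omega),
    Finset.prod_empty, mul_one, ← Finset.prod_mul_distrib]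
  refine Finset.prod_congr rfl fun a ha => ?_
  simp only [Finset.mem_Icc] at ha
  rw [Finset.prod_Icc_succ_top (by omega)]

theorem weylDim_congr {p : ℕ} {μ ν : ℕ → ℤ} (h : ∀ k ∈ Finset.Icc 1 p, μ k = ν k) :
    weylDim p μ = weylDim p ν := by
  refine Finset.prod_congr rfl fun a ha => Finset.prod_congr rfl fun b hb => ?_
  simp only [Finset.mem_Icc] at ha hb
  rw [h a (by simp; omega), h b (by simp; omega)]

variable {d : ℕ} {lam : ℕ → ℕ}

theorem weylDim_ne_zero (hlam : ∀ k, 1 ≤ k → k + 1 ≤ d → lam (k + 1) ≤ lam k) :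
    weylDim d (fun x => (lam x : ℤ)) ≠ 0 := by
  refine Finset.prod_ne_zero_iff.2 fun a ha => Finset.prod_ne_zero_iff.2 fun b hb => ?_
  simp only [Finset.mem_Icc] at ha hb
  have h := one_le_contentDiff hlam ha.1 (i := b) (by omega) hb.2
  have h2 : (a : ℚ) + 1 ≤ b := by exact_mod_cast hb.1
  unfold contentDiff at h
  push_cast
  exact div_ne_zero (by linarith) (by linarith)

theorem weylDim_addBox (hlam : ∀ k, 1 ≤ k → k + 1 ≤ d → lam (k + 1) ≤ lam k)
    {i n : ℕ} (hi : 1 ≤ i) (hin : i ≤ n) (hn : n ≤ d) :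
    weylDim n (addBox (fun x => (lam x : ℤ)) i)
      = weylDim n (fun x => (lam x : ℤ)) * ratioProd lam n i := by
  induction n, hin using Nat.le_induction with
  | base =>
    obtain ⟨p, rfl⟩ : ∃ p, i = p + 1 := ⟨i - 1, by omega⟩
    rw [weylDim_succ, weylDim_succ, ratioProd_succ_self, ratioProd,
      Finset.erase_eq_of_notMem (by simp), mul_assoc, ← Finset.prod_mul_distrib]
    congr 1
    · refine weylDim_congr fun k hk => ?_
      simp only [Finset.mem_Icc] at hk
      simp only [addBox, if_neg (show k ≠ p + 1 by omega), add_zero]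
    · refine Finset.prod_congr rfl fun a ha => ?_
      simp only [Finset.mem_Icc] at ha
      have h := contentDiff_ne_zero hlam hi hn ha.1 (by omega) (show a ≠ p + 1 by omega)
      simp only [addBox, if_neg (show a ≠ p + 1 by omega), if_true, contentDiff] at h ⊢
      push_cast at h ⊢
      rw [div_mul_div_comm, mul_comm, mul_div_mul_right _ _ h]
      ring
  | succ n hin ih =>
    have hi' : i ∈ Finset.Icc 1 n := Finset.mem_Icc.2 ⟨hi, hin⟩
    have h := contentDiff_ne_zero hlam hi (by omega) (by omega) hn (show n + 1 ≠ i by omega)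
    have hprod : ∀ a ∈ (Finset.Icc 1 n).erase i,
        ((addBox (fun x => (lam x : ℤ)) i a : ℚ) - ((lam (n + 1) : ℤ) : ℚ)
            + (((n + 1 : ℕ) : ℚ) - a)) / (((n + 1 : ℕ) : ℚ) - a)
          = (((lam a : ℤ) : ℚ) - ((lam (n + 1) : ℤ) : ℚ)
            + (((n + 1 : ℕ) : ℚ) - a)) / (((n + 1 : ℕ) : ℚ) - a) := fun a ha => by
      simp [addBox, Finset.ne_of_mem_erase ha]
    have hlast : addBox (fun x => (lam x : ℤ)) i (n + 1) = lam (n + 1) := by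
      simp [addBox, show n + 1 ≠ i by omega]
    have hself : addBox (fun x => (lam x : ℤ)) i i = lam i + 1 := by simp [addBox]
    rw [weylDim_succ, weylDim_succ, ih (by omega), ratioProd_succ (by omega), hlast,
      ← Finset.mul_prod_erase _ _ hi', ← Finset.mul_prod_erase _ _ hi', hself]
    have hn' : ((n + 1 : ℕ) : ℚ) - i ≠ 0 := sub_ne_zero.2 (by exact_mod_cast (by omega))
    have hfactor : (((lam i + 1 : ℤ) : ℚ) - ((lam (n + 1) : ℤ) : ℚ) + (((n + 1 : ℕ) : ℚ) - i))
          / (((n + 1 : ℕ) : ℚ) - i)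
        = (((lam i : ℤ) : ℚ) - ((lam (n + 1) : ℤ) : ℚ) + (((n + 1 : ℕ) : ℚ) - i))
          / (((n + 1 : ℕ) : ℚ) - i)
          * ((contentDiff lam i (n + 1) - 1) / contentDiff lam i (n + 1)) := by
      field_simp
      simp only [contentDiff]
      push_cast
      ring
    rw [hfactor, Finset.prod_congr rfl hprod]
    ring

theorem dimR_eq_ratioProd (hlam : ∀ k, 1 ≤ k → k + 1 ≤ d → lam (k + 1) ≤ lam k)
    {i : ℕ} (hi : 1 ≤ i) (hid : i ≤ d) : dimR lam d i = ratioProd lam d i := by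
  rw [dimR, dimRatio, if_pos hid, weylDim_addBox hlam hi hid le_rfl,
    mul_div_cancel_left₀ _ (weylDim_ne_zero hlam)]

end Weyl

section Blocks

variable {d : ℕ} {lam : ℕ → ℕ}

theorem exists_isBlock_filter_eq (hlam : ∀ k, 1 ≤ k → k + 1 ≤ d → lam (k + 1) ≤ lam k)
    {m : ℕ} (hm : m ∈ Finset.Icc 1 d) :
    ∃ a b, IsBlock d lam a b ∧ (Finset.Icc 1 d).filter (fun k => lam k = lam m) = Finset.Icc a b := by
  set S := (Finset.Icc 1 d).filter (fun k => lam k = lam m) with hS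
  have hne : S.Nonempty := ⟨m, by simp [hS, Finset.mem_Icc.1 hm]⟩
  have mem : ∀ k, k ∈ S ↔ (1 ≤ k ∧ k ≤ d) ∧ lam k = lam m := by simp [hS]
  obtain ⟨a, haS, hmin⟩ : ∃ a ∈ S, ∀ k ∈ S, a ≤ k := ⟨_, S.min'_mem hne, S.min'_le⟩
  obtain ⟨b, hbS, hmax⟩ : ∃ b ∈ S, ∀ k ∈ S, k ≤ b := ⟨_, S.max'_mem hne, S.le_max'⟩
  have ha := (mem a).1 haS
  have hb := (mem b).1 hbS
  have hab : a ≤ b := hmin b hbS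
  refine ⟨a, b, ⟨ha.1.1, hab, hb.1.2, ha.2.trans hb.2.symm, ?_, ?_⟩, ?_⟩
  · by_contra! h
    have h1 := hlam (a - 1) (by omega) (by omega)
    rw [Nat.sub_add_cancel ha.1.1] at h1
    have := hmin (a - 1) ((mem _).2 ⟨by omega, by omega⟩)
    omega
  · by_contra! h
    have h1 := hlam b hb.1.1 (by omega)
    have := hmax (b + 1) ((mem _).2 ⟨by omega, by omega⟩)
    omega
  · ext k
    rw [Finset.mem_Icc]
    refine ⟨fun hk => ⟨hmin k hk, hmax k hk⟩, fun hk => (mem k).2 ⟨by omega, ?_⟩⟩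
    have h1 := rows_antitone hlam ha.1.1 hk.1 (by omega)
    have h2 := rows_antitone hlam (by omega) hk.2 hb.1.2
    omega

theorem sum_mul_eq_sum_mul_of_block_sums
    (hlam : ∀ k, 1 ≤ k → k + 1 ≤ d → lam (k + 1) ≤ lam k) {μ ν c : ℕ → ℝ}
    (hblock : ∀ a b, IsBlock d lam a b → ∑ m ∈ Finset.Icc a b, μ m = ∑ m ∈ Finset.Icc a b, ν m)
    (hc : ∀ a b, IsBlock d lam a b → ∀ k ∈ Finset.Icc a b, c k = c a) :
    ∑ k ∈ Finset.Icc 1 d, μ k * c k = ∑ k ∈ Finset.Icc 1 d, ν k * c k := by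
  have hmaps : ∀ k ∈ Finset.Icc 1 d, lam k ∈ (Finset.Icc 1 d).image lam :=
    fun k hk => Finset.mem_image_of_mem lam hk
  rw [← Finset.sum_fiberwise_of_maps_to hmaps, ← Finset.sum_fiberwise_of_maps_to hmaps]
  refine Finset.sum_congr rfl fun v hv => ?_
  obtain ⟨m, hm, rfl⟩ := Finset.mem_image.1 hv
  obtain ⟨a, b, hab, hfilter⟩ := exists_isBlock_filter_eq hlam hm
  rw [hfilter]
  have key : ∀ f : ℕ → ℝ,
      ∑ k ∈ Finset.Icc a b, f k * c k = (∑ k ∈ Finset.Icc a b, f k) * c a := fun f => by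
    rw [Finset.sum_mul]
    exact Finset.sum_congr rfl fun k hk => by rw [hc a b hab k hk]
  rw [key, key, hblock a b hab]

theorem row_eq_of_isBlock (hlam : ∀ k, 1 ≤ k → k + 1 ≤ d → lam (k + 1) ≤ lam k)
    {a b k : ℕ} (hab : IsBlock d lam a b) (hk : k ∈ Finset.Icc a b) : lam k = lam a := by
  obtain ⟨ha, -, hb, heq, -, -⟩ := hab
  rw [Finset.mem_Icc] at hk
  have h1 := rows_antitone hlam ha hk.1 (by omega)
  have h2 := rows_antitone hlam (by omega) hk.2 hb
  omega

theorem donate_of_isBlock (hlam : ∀ k, 1 ≤ k → k + 1 ≤ d → lam (k + 1) ≤ lam k)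
    {a b k : ℕ} (hab : IsBlock d lam a b) (hk : k ∈ Finset.Icc a b) :
    donate d lam k = lam k + 1 - a + d - b := by
  have hrow := row_eq_of_isBlock hlam hab hk
  obtain ⟨ha, hle, hb, heq, hl, hr⟩ := hab
  rw [Finset.mem_Icc] at hk
  have h1 : (Finset.Icc 1 d).filter (fun j => j < k ∧ lam k < lam j) = Finset.Icc 1 (a - 1) := by
    ext j
    simp only [Finset.mem_filter, Finset.mem_Icc]
    constructor
    · rintro ⟨hj, hjk, hlt⟩
      by_contra h
      have := rows_antitone hlam ha (show a ≤ j by omega) hj.2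
      omega
    · rintro ⟨hj, hja⟩
      have := rows_antitone hlam hj hja (by omega)
      omega
  have h2 : (Finset.Icc 1 d).filter (fun j => k < j ∧ lam j < lam k) = Finset.Icc (b + 1) d := by
    ext j
    simp only [Finset.mem_filter, Finset.mem_Icc]
    constructor
    · rintro ⟨hj, hjk, hlt⟩
      by_contra h
      have := rows_antitone hlam hj.1 (show j ≤ b by omega) hb
      omega
    · rintro ⟨hj, hjd⟩
      have := rows_antitone hlam (by omega) hj hjd
      omega
  rw [donate, h1, h2, Nat.card_Icc, Nat.card_Icc]
  omega

theorem sum_Icc_two_mul {a b : ℕ} (hab : a ≤ b) :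
    ∑ k ∈ Finset.Icc a b, (2 * k : ℝ) = ((b : ℝ) + 1 - a) * (a + b) := by
  induction b, hab using Nat.le_induction with
  | base => simp; ring
  | succ n hn ih =>
    rw [Finset.sum_Icc_succ_top (by omega), ih]
    push_cast
    ring

theorem sum_donate_of_isBlock (hlam : ∀ k, 1 ≤ k → k + 1 ≤ d → lam (k + 1) ≤ lam k)
    {a b : ℕ} (hab : IsBlock d lam a b) :
    ∑ m ∈ Finset.Icc a b, (donate d lam m : ℝ)
      = ∑ m ∈ Finset.Icc a b, ((lam m : ℝ) + d + 1 - 2 * m) := by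
  have hle := hab.2.1
  have h : ∀ m ∈ Finset.Icc a b, (donate d lam m : ℝ) = lam m + (1 - a + d - b) := by
    intro m hm
    rw [donate_of_isBlock hlam hab hm]
    push_cast
    ring
  rw [Finset.sum_congr rfl h, Finset.sum_sub_distrib, sum_Icc_two_mul hle]
  simp only [Finset.sum_add_distrib, Finset.sum_const, Nat.card_Icc, nsmul_eq_mul]
  rw [Nat.cast_sub (by omega)]
  push_cast
  ring

end Blocks

theorem first_moment_legal_transformation
    (d : ℕ) (hd : 1 ≤ d) (lam : ℕ → ℕ)
    (hlam : ∀ k, 1 ≤ k → k + 1 ≤ d → lam (k + 1) ≤ lam k)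
    (μ : ℕ → ℝ)
    (hμ : ∀ a b : ℕ, IsBlock d lam a b →
      ∑ m ∈ Finset.Icc a b, μ m = ∑ m ∈ Finset.Icc a b, ((donate d lam m : ℝ)))
    (i : ℕ) (hi : i ∈ Finset.Icc 1 d) :
    ∑ k ∈ Finset.Icc 1 d, μ k * ((csq lam k i : ℝ))
      = ((lam i : ℝ) + 1 - (i : ℝ)) * ((dimR lam d i : ℝ)) := by
  rw [Finset.mem_Icc] at hi
  rw [sum_mul_eq_sum_mul_of_block_sums hlam
    (fun a b hab => (hμ a b hab).trans (sum_donate_of_isBlock hlam hab)) fun a b hab k hk => ?_]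
  · rw [dimR_eq_ratioProd hlam hi.1 hi.2]
    exact_mod_cast congrArg (Rat.cast : ℚ → ℝ) (sum_staircase_mul_csq hlam hi.1 hi.2 le_rfl)
  · have hrow := row_eq_of_isBlock hlam hab hk
    rw [Finset.mem_Icc] at hk
    exact_mod_cast csq_eq_of_row_eq hlam hi.1 hi.2 hab.1 hk.1 (hk.2.trans hab.2.2.1) hrow
end

section
/- The rank-r staircase transformation is a legal Young-diagram transformation: let λ be a Young diagram with at most d rows, let r ∈ [d], and suppose λ_k = 0 for every k > r. Define s_k := λ_k + d − 2k + 1 for 1 ≤ k ≤ r and s_k := −r for r < k ≤ d. Then for every block B of λ, ∑_{k∈B} s_k = ∑_{k∈B} λ↑_k. -/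
open Finset

lemma le_of_antitone_Icc {d : ℕ} {lam : ℕ → ℕ}
    (hlam : ∀ k, 1 ≤ k → k + 1 ≤ d → lam (k + 1) ≤ lam k)
    {i j : ℕ} (hi : 1 ≤ i) (hij : i ≤ j) (hj : j ≤ d) : lam j ≤ lam i := by
  induction j, hij using Nat.le_induction with
  | base => exact le_rfl
  | succ n hn ih => exact (hlam n (by omega) hj).trans (ih (by omega))

/-- On a block `{a, …, b}`, each row gives to `a - 1` rows and receives from `d - b` rows. -/
lemma donate_eq_of_isBlock {d : ℕ} {lam : ℕ → ℕ}
    (hlam : ∀ k, 1 ≤ k → k + 1 ≤ d → lam (k + 1) ≤ lam k)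
    {a b k : ℕ} (hB : IsBlock d lam a b) (hk : k ∈ Icc a b) :
    lam k = lam a ∧ donate d lam k = (lam a : ℤ) + d + 1 - a - b := by
  obtain ⟨ha, hab, hbd, heq, hl, hr⟩ := hB
  rw [mem_Icc] at hk
  have hmono : ∀ {i j : ℕ}, 1 ≤ i → i ≤ j → j ≤ d → lam j ≤ lam i :=
    fun hi hij hj => le_of_antitone_Icc hlam hi hij hj
  have hconst : ∀ j, a ≤ j → j ≤ b → lam j = lam a := fun j h₁ h₂ => by
    have := hmono ha h₁ (h₂.trans hbd)
    have := hmono (ha.trans h₁) h₂ hbd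
    omega
  have hka := hconst k hk.1 hk.2
  have hbefore : (Icc 1 d).filter (fun j => j < k ∧ lam k < lam j) = Ico 1 a := by
    ext j
    simp only [mem_filter, mem_Icc, mem_Ico]
    constructor
    · rintro ⟨⟨h₁, _⟩, h₂, h₃⟩
      refine ⟨h₁, ?_⟩
      by_contra! h
      have := hconst j h (by omega)
      omega
    · rintro ⟨h₁, h₂⟩
      have := hmono h₁ (show j ≤ a - 1 by omega) (by omega)
      exact ⟨⟨h₁, by omega⟩, by omega, by omega⟩
  have hafter : (Icc 1 d).filter (fun j => k < j ∧ lam j < lam k) = Ioc b d := by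
    ext j
    simp only [mem_filter, mem_Icc, mem_Ioc]
    constructor
    · rintro ⟨⟨_, h₁⟩, h₂, h₃⟩
      refine ⟨?_, h₁⟩
      by_contra! h
      have := hconst j (by omega) h
      omega
    · rintro ⟨h₁, h₂⟩
      have := hmono (show 1 ≤ b + 1 by omega) (show b + 1 ≤ j by omega) h₂
      exact ⟨⟨by omega, h₂⟩, by omega, by omega⟩
  refine ⟨hka, ?_⟩
  rw [donate, hbefore, hafter, Nat.card_Ico, Nat.card_Ioc, hka]
  omega

lemma sum_Icc_sub_two_mul (c : ℤ) {a n : ℕ} (h : a ≤ n + 1) :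
    ∑ k ∈ Icc a n, (c - 2 * (k : ℤ)) = ((n : ℤ) + 1 - a) * (c - a - n) := by
  obtain rfl | h := h.eq_or_lt
  · simp
  replace h : a ≤ n := by omega
  induction n, h using Nat.le_induction with
  | base => simp; ring
  | succ n hn ih =>
    rw [sum_Icc_succ_top (by omega), ih (by omega)]
    push_cast
    ring

lemma sum_Icc_staircase (c : ℤ) {a r n : ℕ} (ha : a ≤ r + 1) (hn : r ≤ n) :
    ∑ k ∈ Icc a n, (if k ≤ r then c - 2 * (k : ℤ) else -(r : ℤ))
      = ((r : ℤ) + 1 - a) * (c - a - r) - r * ((n : ℤ) - r) := by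
  induction n, hn using Nat.le_induction with
  | base =>
    rw [sum_congr rfl fun k hk => if_pos (mem_Icc.mp hk).2, sum_Icc_sub_two_mul c ha]
    ring
  | succ n hn ih =>
    rw [sum_Icc_succ_top (by omega), ih, if_neg (by omega)]
    push_cast
    ring

theorem rank_r_staircase_is_legal
    (d : ℕ) (hd : 1 ≤ d) (lam : ℕ → ℕ)
    (hlam : ∀ k, 1 ≤ k → k + 1 ≤ d → lam (k + 1) ≤ lam k)
    (r : ℕ) (hr : r ∈ Finset.Icc 1 d)
    (hrank : ∀ k, r < k → k ≤ d → lam k = 0)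
    (a b : ℕ) (hB : IsBlock d lam a b) :
    ∑ k ∈ Finset.Icc a b,
        (if k ≤ r then (lam k : ℤ) + (d : ℤ) - 2 * (k : ℤ) + 1 else -(r : ℤ))
      = ∑ k ∈ Finset.Icc a b, donate d lam k := by
  rw [mem_Icc] at hr
  have hblock := fun k hk => donate_eq_of_isBlock (k := k) hlam hB hk
  obtain ⟨ha, hab, hbd, heq, hl, hb⟩ := hB
  rw [sum_congr rfl fun k hk => (hblock k hk).2, sum_const, Nat.card_Icc, nsmul_eq_mul,
    Nat.cast_sub (by omega)]
  have hsummand : ∀ k ∈ Icc a b,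
      (if k ≤ r then (lam k : ℤ) + (d : ℤ) - 2 * (k : ℤ) + 1 else -(r : ℤ))
        = if k ≤ r then ((lam a : ℤ) + d + 1) - 2 * (k : ℤ) else -(r : ℤ) := fun k hk => by
    rw [(hblock k hk).1]
    congr 1
    ring
  rw [sum_congr rfl hsummand]
  rcases le_or_gt b r with hbr | hbr
  · rw [sum_congr rfl fun k hk => if_pos ((mem_Icc.mp hk).2.trans hbr),
      sum_Icc_sub_two_mul _ (by omega)]
    push_cast
    ring
  · have hb0 := hrank b hbr hbd
    have ha0 : lam a = 0 := heq.trans hb0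
    have hbd' : b = d := by omega
    have har : a ≤ r + 1 := by
      by_contra! h
      have := hrank (a - 1) (by omega) (by omega)
      omega
    rw [sum_Icc_staircase _ har hbr.le, ha0, hbd']
    push_cast
    ring
end
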